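/- If a bipartite graph G has 1-expansion up to K, and every left set S with K < #S ≤ 2K satisfies #N(S) ≥ #S + K, then G has dynamic matching up to K (with load 1). -/

import Mathlib

/-!
Bipartite graphs are modelled by a neighborhood function `Nbr : L → Finset R`
on finite types `L` (left nodes) and `R` (right nodes).

The dynamic matching game with parameters `K` and `ℓ` (the load):
Requester and Matcher maintain a set `M` of edges, initially empty, and alternate
turns with Requester first.  At round `n`, Requester removes a set of edges from `M`
(so that afterwards `#M ≤ K - 1`) and selects a left node; Matcher replies, according
to her strategy, by adding one edge of the graph incident on the selected node,
and afterwards every right node must be incident on at most `ℓ` edges of `M`.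
A strategy is winning if against every legal play of Requester all these
conditions always hold.
-/

namespace DM

/-- A Requester move: a set of edges to remove from the matching, and the requested left node. -/
abbrev ReqMove (α β : Type) := Finset (α × β) × α

/-- A Matcher strategy: maps each finite history of Requester moves to the set of
edges Matcher adds (a valid reply adds exactly one edge incident on the request). -/
abbrev Strategy (α β : Type) := List (ReqMove α β) → Finset (α × β)

/-- A Requester move in the ε-rich game: a set of left nodes whose requests are retracted
(all their matched edges are removed together), and the requested left node. -/
abbrev RReqMove (α : Type) := Finset α × α

/-- A Matcher strategy in the ε-rich game: maps each finite history of Requester moves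
to the set of edges Matcher adds. -/
abbrev RStrategy (α β : Type) := List (RReqMove α) → Finset (α × β)

variable {L R R₁ R₂ : Type} [DecidableEq L] [DecidableEq R] [DecidableEq R₁] [DecidableEq R₂]

/-- The set of neighbors of a set `S` of left nodes. -/
def NbrSet (Nbr : L → Finset R) (S : Finset L) : Finset R := S.biUnion Nbr

/-- The graph has `e`-expansion up to `K`: every left set `S` with `#S ≤ K`
has at least `e · #S` neighbors. -/
def Expansion (Nbr : L → Finset R) (e : ℚ) (K : ℕ) : Prop :=
  ∀ S : Finset L, S.card ≤ K → e * (S.card : ℚ) ≤ ((NbrSet Nbr S).card : ℚ)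

/-- The `ℓ`-clone of a graph: `ℓ` copies of the right set, with `x` adjacent to `(y, i)`
iff `x` is adjacent to `y` in the original graph. -/
def clone (ℓ : ℕ) (Nbr : L → Finset R) : L → Finset (R × Fin ℓ) :=
  fun x => (Nbr x) ×ˢ (Finset.univ : Finset (Fin ℓ))

/-- The product of two graphs with the same left set: `x` is adjacent to `(y₁, y₂)` iff
`x` is adjacent to `y₁` in the first graph and to `y₂` in the second graph. -/
def prodGraph (Nbr₁ : L → Finset R₁) (Nbr₂ : L → Finset R₂) : L → Finset (R₁ × R₂) :=
  fun x => (Nbr₁ x) ×ˢ (Nbr₂ x)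

/-- The private neighbors of a left set `S`: right nodes with exactly one neighbor in `S`. -/
def privNbrs [Fintype R] (Nbr : L → Finset R) (S : Finset L) : Finset R :=
  Finset.univ.filter fun y => (S.filter fun x => y ∈ Nbr x).card = 1

/-- The history of Requester moves after round `n` (i.e. the moves of rounds `0, …, n`). -/
def histUpTo (req : ℕ → ReqMove L R) (n : ℕ) : List (ReqMove L R) :=
  List.ofFn fun i : Fin (n + 1) => req i.1

/-- The matching `M` after round `n` of play: at round `n`, Requester removes the edges
`(req n).1` and requests `(req n).2`, then Matcher adds the edge(s) given by her strategy. -/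
def matchingAfter (σ : Strategy L R) (req : ℕ → ReqMove L R) : ℕ → Finset (L × R)
  | 0 => ∅
  | n + 1 => σ (histUpTo req n) ∪ (matchingAfter σ req n \ (req n).1)

/-- Requester's move at round `n` is legal: after his removal, `#M ≤ K - 1`. -/
def RemLegal (σ : Strategy L R) (K : ℕ) (req : ℕ → ReqMove L R) (n : ℕ) : Prop :=
  (matchingAfter σ req n \ (req n).1).card < K

/-- Matcher's reply at round `n` is valid for load `ℓ`: she adds exactly one edge of the
graph, incident on the requested node, and afterwards every right node is incident on
at most `ℓ` edges of `M`. -/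
def ValidReply (Nbr : L → Finset R) (ℓ : ℕ) (σ : Strategy L R)
    (req : ℕ → ReqMove L R) (n : ℕ) : Prop :=
  (∃ y ∈ Nbr (req n).2, σ (histUpTo req n) = {((req n).2, y)}) ∧
  ∀ y : R, ((matchingAfter σ req (n + 1)).filter fun p => p.2 = y).card ≤ ℓ

/-- The graph has dynamic matching up to `K` with load `ℓ`: Matcher has a strategy that
replies validly to every legal play of Requester. -/
def DynamicMatching (Nbr : L → Finset R) (K ℓ : ℕ) : Prop :=
  ∃ σ : Strategy L R, ∀ req : ℕ → ReqMove L R, ∀ n : ℕ,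
    (∀ i ≤ n, RemLegal σ K req i) → ValidReply Nbr ℓ σ req n

/-- Incremental matching up to `K` with load `ℓ`: Requester never removes edges,
and the game lasts at most `K` rounds. -/
def IncrementalMatching (Nbr : L → Finset R) (K ℓ : ℕ) : Prop :=
  ∃ σ : Strategy L R, ∀ req : ℕ → ReqMove L R, (∀ i, (req i).1 = ∅) →
    ∀ n < K, ValidReply Nbr ℓ σ req n

/-- Matching with `T` rounds up to `K` with load `ℓ`: the dynamic matching game is
terminated after `T` rounds. -/
def RoundMatching (Nbr : L → Finset R) (T K ℓ : ℕ) : Prop :=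
  ∃ σ : Strategy L R, ∀ req : ℕ → ReqMove L R, ∀ n < T,
    (∀ i ≤ n, RemLegal σ K req i) → ValidReply Nbr ℓ σ req n

/-- The edge Matcher added at round `i` is removed by Requester during one of the
rounds `i + 1, …, i + T`. -/
def ExpiredAt (σ : Strategy L R) (T : ℕ) (req : ℕ → ReqMove L R) (i : ℕ) : Prop :=
  ∃ j, i < j ∧ j ≤ i + T ∧ ∀ e ∈ σ (histUpTo req i), e ∈ (req j).1

/-- Matching up to `K` with `T`-expiration and load `ℓ`: the dynamic matching game in
which Requester must remove the edge added at round `i` during one of the rounds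
`i + 1, …, i + T`. -/
def ExpiringMatching (Nbr : L → Finset R) (T K ℓ : ℕ) : Prop :=
  ∃ σ : Strategy L R, ∀ req : ℕ → ReqMove L R, ∀ n : ℕ,
    (∀ i ≤ n, RemLegal σ K req i) → (∀ i, i + T ≤ n → ExpiredAt σ T req i) →
    ValidReply Nbr ℓ σ req n

/-! ### The ε-rich matching game

In the ε-rich game on a graph with left degree `D`, when Requester requests a left node
`x`, Matcher adds to `M` in one round a set of at least `(1 - ε) · D` edges incident on
`x`; when Requester retracts a request, all its edges are removed together. -/

/-- The history of rich-game Requester moves after round `n`. -/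
def rhistUpTo (req : ℕ → RReqMove L) (n : ℕ) : List (RReqMove L) :=
  List.ofFn fun i : Fin (n + 1) => req i.1

/-- The matching `M` after round `n` of the rich game: at round `n`, Requester retracts
the requests of the left nodes in `(req n).1` (removing all their edges) and requests
`(req n).2`, then Matcher adds the set of edges given by her strategy. -/
def rmatchingAfter (σ : RStrategy L R) (req : ℕ → RReqMove L) : ℕ → Finset (L × R)
  | 0 => ∅
  | n + 1 => σ (rhistUpTo req n) ∪
      ((rmatchingAfter σ req n).filter fun p => p.1 ∉ (req n).1)

/-- Requester's rich-game move at round `n` is legal: after the retraction, at most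
`K - 1` requests remain matched. -/
def RRemLegal (σ : RStrategy L R) (K : ℕ) (req : ℕ → RReqMove L) (n : ℕ) : Prop :=
  ((((rmatchingAfter σ req n).filter fun p => p.1 ∉ (req n).1)).image Prod.fst).card < K

/-- Matcher's rich reply at round `n` is valid for richness `ε` (relative to left degree
`D`) and load `ℓ`: she adds at least `(1 - ε) · D` edges of the graph, all incident on
the requested node, and afterwards every right node is incident on at most `ℓ` edges. -/
def RValidReply (Nbr : L → Finset R) (D : ℕ) (ε : ℚ) (ℓ : ℕ) (σ : RStrategy L R)
    (req : ℕ → RReqMove L) (n : ℕ) : Prop :=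
  (∀ e ∈ σ (rhistUpTo req n), e.1 = (req n).2 ∧ e.2 ∈ Nbr e.1) ∧
  (1 - ε) * (D : ℚ) ≤ ((σ (rhistUpTo req n)).card : ℚ) ∧
  ∀ y : R, ((rmatchingAfter σ req (n + 1)).filter fun p => p.2 = y).card ≤ ℓ

/-- ε-rich matching up to `K` with load `ℓ` (richness relative to left degree `D`). -/
def RichMatching (Nbr : L → Finset R) (D : ℕ) (ε : ℚ) (K ℓ : ℕ) : Prop :=
  ∃ σ : RStrategy L R, ∀ req : ℕ → RReqMove L, ∀ n : ℕ,
    (∀ i ≤ n, RRemLegal σ K req i) → RValidReply Nbr D ε ℓ σ req n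

/-- Incremental ε-rich matching up to `K` with load `ℓ`: Requester never retracts,
and the game lasts at most `K` rounds. -/
def RichIncrementalMatching (Nbr : L → Finset R) (D : ℕ) (ε : ℚ) (K ℓ : ℕ) : Prop :=
  ∃ σ : RStrategy L R, ∀ req : ℕ → RReqMove L, (∀ i, (req i).1 = ∅) →
    ∀ n < K, RValidReply Nbr D ε ℓ σ req n

/-- ε-rich matching up to `K` with `T`-expiration and load `ℓ`: Requester must retract
the request made at round `i` during one of the rounds `i + 1, …, i + T`. -/
def RichExpiringMatching (Nbr : L → Finset R) (D : ℕ) (ε : ℚ) (T K ℓ : ℕ) : Prop :=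
  ∃ σ : RStrategy L R, ∀ req : ℕ → RReqMove L, ∀ n : ℕ,
    (∀ i ≤ n, RRemLegal σ K req i) →
    (∀ i, i + T ≤ n → ∃ j, i < j ∧ j ≤ i + T ∧ (req i).2 ∈ (req j).1) →
    RValidReply Nbr D ε ℓ σ req n

end DM

namespace DM

section DynamicInvariant

variable {L R : Type} [DecidableEq L] [DecidableEq R]

/-- The neighbors of `S` that `M` does not match to a left node outside `S`. -/
def availNbrs (Nbr : L → Finset R) (M : Finset (L × R)) (S : Finset L) : Finset R :=
  NbrSet Nbr S \ (M.filter fun p => p.1 ∉ S).image Prod.snd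

/-- `M` is a set of edges with load one such that every left set of size at most `K` keeps
at least as many available neighbors as it has elements. -/
structure IsSafe (Nbr : L → Finset R) (K : ℕ) (M : Finset (L × R)) : Prop where
  edge : ∀ p ∈ M, p.2 ∈ Nbr p.1
  inj : ∀ p ∈ M, ∀ q ∈ M, p.2 = q.2 → p = q
  avail : ∀ S : Finset L, S.card ≤ K → S.card ≤ (availNbrs Nbr M S).card

variable {Nbr : L → Finset R} {K : ℕ} {M : Finset (L × R)}

theorem mem_availNbrs {S : Finset L} {y : R} :
    y ∈ availNbrs Nbr M S ↔ (∃ a ∈ S, y ∈ Nbr a) ∧ ∀ a, (a, y) ∈ M → a ∈ S := by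
  simp only [availNbrs, NbrSet, Finset.mem_sdiff, Finset.mem_biUnion, Finset.mem_image,
    Finset.mem_filter, Prod.exists, exists_eq_right, not_exists, not_and, not_not]

theorem isSafe_empty (hexp : Expansion Nbr 1 K) : IsSafe Nbr K ∅ where
  edge := by simp
  inj := by simp
  avail S hS := by
    have h := hexp S hS
    rw [one_mul] at h
    simpa [availNbrs] using (Nat.cast_le.mp h)

theorem IsSafe.mono {M' : Finset (L × R)} (hM : IsSafe Nbr K M) (h : M' ⊆ M) :
    IsSafe Nbr K M' where
  edge p hp := hM.edge p (h hp)
  inj p hp q hq := hM.inj p (h hp) q (h hq)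
  avail S hS := (hM.avail S hS).trans <| Finset.card_le_card fun y hy => by
    rw [mem_availNbrs] at hy ⊢
    exact ⟨hy.1, fun a ha => hy.2 a (h ha)⟩

theorem IsSafe.card_availNbrs_union_add_inter (hM : IsSafe Nbr K M) (S T : Finset L) :
    (availNbrs Nbr M (S ∪ T)).card + (availNbrs Nbr M (S ∩ T)).card ≤
      (availNbrs Nbr M S).card + (availNbrs Nbr M T).card := by
  rw [← Finset.card_union_add_card_inter (availNbrs Nbr M S)]
  refine Nat.add_le_add (Finset.card_le_card fun y hy => ?_) (Finset.card_le_card fun y hy => ?_)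
  · rw [Finset.mem_union]
    rw [mem_availNbrs] at hy
    obtain ⟨⟨a, ha, hay⟩, hmem⟩ := hy
    by_cases hy' : ∃ b, (b, y) ∈ M
    · obtain ⟨b, hb⟩ := hy'
      have huniq : ∀ c, (c, y) ∈ M → c = b := fun c hc =>
        congrArg Prod.fst (hM.inj _ hc _ hb rfl)
      refine (Finset.mem_union.mp (hmem b hb)).imp (fun h => ?_) (fun h => ?_) <;>
      · rw [mem_availNbrs]
        exact ⟨⟨b, h, hM.edge _ hb⟩, fun c hc => huniq c hc ▸ h⟩
    · push Not at hy'
      refine (Finset.mem_union.mp ha).imp (fun h => ?_) (fun h => ?_) <;>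
      · rw [mem_availNbrs]
        exact ⟨⟨a, h, hay⟩, fun c hc => absurd hc (hy' c)⟩
  · rw [mem_availNbrs] at hy
    obtain ⟨⟨a, ha, hay⟩, hmem⟩ := hy
    rw [Finset.mem_inter] at ha ⊢
    rw [mem_availNbrs, mem_availNbrs]
    exact ⟨⟨⟨a, ha.1, hay⟩, fun c hc => (Finset.mem_inter.mp (hmem c hc)).1⟩,
      ⟨⟨a, ha.2, hay⟩, fun c hc => (Finset.mem_inter.mp (hmem c hc)).2⟩⟩

theorem card_lt_card_availNbrs
    (hbig : ∀ S : Finset L, K < S.card → S.card ≤ 2 * K →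
      S.card + K ≤ (NbrSet Nbr S).card)
    (hK : M.card < K) {S : Finset L} (h₁ : K < S.card) (h₂ : S.card ≤ 2 * K) :
    S.card < (availNbrs Nbr M S).card := by
  have hb := hbig S h₁ h₂
  have hle : ((M.filter fun p => p.1 ∉ S).image Prod.snd).card ≤ M.card :=
    Finset.card_image_le.trans (Finset.card_filter_le _ _)
  have := Finset.le_card_sdiff ((M.filter fun p => p.1 ∉ S).image Prod.snd) (NbrSet Nbr S)
  rw [availNbrs]
  omega

/-- The critical sets, those of size at most `K` with no spare available neighbor,
are closed under union. -/
theorem IsSafe.critical_union (hM : IsSafe Nbr K M)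
    (hbig : ∀ S : Finset L, K < S.card → S.card ≤ 2 * K →
      S.card + K ≤ (NbrSet Nbr S).card)
    (hK : M.card < K) {S T : Finset L}
    (hS : S.card ≤ K ∧ (availNbrs Nbr M S).card ≤ S.card)
    (hT : T.card ≤ K ∧ (availNbrs Nbr M T).card ≤ T.card) :
    (S ∪ T).card ≤ K ∧ (availNbrs Nbr M (S ∪ T)).card ≤ (S ∪ T).card := by
  have hsub := hM.card_availNbrs_union_add_inter S T
  have hcard := Finset.card_union_add_card_inter S T
  have hinter := hM.avail (S ∩ T) ((Finset.card_le_card Finset.inter_subset_left).trans hS.1)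
  have hle : (availNbrs Nbr M (S ∪ T)).card ≤ (S ∪ T).card := by omega
  refine ⟨not_lt.mp fun hlt => ?_, hle⟩
  have := card_lt_card_availNbrs hbig hK hlt (by omega)
  omega

/-- If a free neighbor `y` of an unmatched node `x` cannot be used, then `y` is available
to a critical set that avoids `x`. -/
theorem IsSafe.exists_critical_of_not_isSafe_insert (hM : IsSafe Nbr K M) {x : L} {y : R}
    (hxy : y ∈ Nbr x) (hy : ∀ a, (a, y) ∉ M) (hbad : ¬ IsSafe Nbr K (insert (x, y) M)) :
    ∃ S : Finset L, x ∉ S ∧ (S.card ≤ K ∧ (availNbrs Nbr M S).card ≤ S.card) ∧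
      ∃ a ∈ S, y ∈ Nbr a := by
  by_contra! hno
  refine hbad ⟨?_, ?_, fun S hS => ?_⟩
  · intro p hp
    rcases Finset.mem_insert.mp hp with rfl | hp
    exacts [hxy, hM.edge p hp]
  · rintro ⟨a, b⟩ hp ⟨c, d⟩ hq (rfl : b = d)
    rw [Finset.mem_insert] at hp hq
    rcases hp with hp | hp <;> rcases hq with hq | hq
    · rw [hp, hq]
    · obtain ⟨-, rfl⟩ := Prod.mk.inj hp
      exact absurd hq (hy c)
    · obtain ⟨-, rfl⟩ := Prod.mk.inj hq
      exact absurd hp (hy a)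
    · exact hM.inj _ hp _ hq rfl
  · have hsafe := hM.avail S hS
    have hsub : x ∈ S ∨ y ∉ availNbrs Nbr M S →
        availNbrs Nbr M S ⊆ availNbrs Nbr (insert (x, y) M) S := by
      intro h z hz
      have hz' := mem_availNbrs.mp hz
      refine mem_availNbrs.mpr ⟨hz'.1, fun a ha => ?_⟩
      rcases Finset.mem_insert.mp ha with ha | ha
      · obtain ⟨rfl, rfl⟩ := Prod.mk.inj ha
        exact h.resolve_right (not_not.mpr hz)
      · exact hz'.2 a ha
    by_cases h : x ∈ S ∨ y ∉ availNbrs Nbr M S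
    · exact hsafe.trans (Finset.card_le_card (hsub h))
    · push Not at h
      have herase : (availNbrs Nbr M S).erase y ⊆ availNbrs Nbr (insert (x, y) M) S := by
        intro z hz
        obtain ⟨hzy, hz⟩ := Finset.mem_erase.mp hz
        have hz' := mem_availNbrs.mp hz
        refine mem_availNbrs.mpr ⟨hz'.1, fun a ha => ?_⟩
        rcases Finset.mem_insert.mp ha with ha | ha
        · exact absurd (Prod.mk.inj ha).2 hzy
        · exact hz'.2 a ha
      have hcard := Finset.card_le_card herase
      rw [Finset.card_erase_of_mem h.2] at hcard
      have hlt : S.card < (availNbrs Nbr M S).card := by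
        by_contra! hle
        obtain ⟨a, ha, hay⟩ := (mem_availNbrs.mp h.2).1
        exact hno S h.1 ⟨hS, hle⟩ a ha hay
      omega

theorem IsSafe.exists_isSafe_insert [Fintype L] (hM : IsSafe Nbr K M)
    (hbig : ∀ S : Finset L, K < S.card → S.card ≤ 2 * K →
      S.card + K ≤ (NbrSet Nbr S).card)
    (hK : M.card < K) (x : L) : ∃ y ∈ Nbr x, IsSafe Nbr K (insert (x, y) M) := by
  classical
  by_cases hx : ∃ y, (x, y) ∈ M
  · obtain ⟨y, hy⟩ := hx
    exact ⟨y, hM.edge _ hy, by rwa [Finset.insert_eq_of_mem hy]⟩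
  push Not at hx
  by_contra! hbad
  set critical : Finset (Finset L) := Finset.univ.filter fun S =>
    x ∉ S ∧ S.card ≤ K ∧ (availNbrs Nbr M S).card ≤ S.card with hcritical
  set T := critical.sup id
  have hT : x ∉ T ∧ T.card ≤ K ∧ (availNbrs Nbr M T).card ≤ T.card := by
    refine Finset.sup_induction (p := fun S : Finset L =>
      x ∉ S ∧ S.card ≤ K ∧ (availNbrs Nbr M S).card ≤ S.card) ?_ ?_ ?_
    · simp [availNbrs, NbrSet]
    · intro S hS S' hS'
      refine ⟨?_, hM.critical_union hbig hK hS.2 hS'.2⟩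
      simpa using ⟨hS.1, hS'.1⟩
    · intro S hS
      simpa [hcritical] using hS
  have hcover : ∀ y ∈ Nbr x, (∀ a, (a, y) ∉ M) → ∃ a ∈ T, y ∈ Nbr a := by
    intro y hxy hy
    obtain ⟨S, hxS, hS, a, ha, hay⟩ :=
      hM.exists_critical_of_not_isSafe_insert hxy hy (hbad y hxy)
    have hST : S ⊆ T := Finset.le_sup (f := id) (by simpa [hcritical] using ⟨hxS, hS⟩)
    exact ⟨a, hST ha, hay⟩
  have hsub : availNbrs Nbr M (insert x T) ⊆ availNbrs Nbr M T := by
    intro y hy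
    obtain ⟨⟨a, ha, hay⟩, hmem⟩ := mem_availNbrs.mp hy
    have hmemT : ∀ b, (b, y) ∈ M → b ∈ T := fun b hb =>
      (Finset.mem_insert.mp (hmem b hb)).resolve_left fun h => hx y (h ▸ hb)
    refine mem_availNbrs.mpr ⟨?_, hmemT⟩
    by_cases hy' : ∃ b, (b, y) ∈ M
    · obtain ⟨b, hb⟩ := hy'
      exact ⟨b, hmemT b hb, hM.edge _ hb⟩
    · push Not at hy'
      rcases Finset.mem_insert.mp ha with rfl | ha
      exacts [hcover y hay hy', ⟨a, ha, hay⟩]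
  have hcard := Finset.card_le_card hsub
  have hins := Finset.card_insert_of_notMem hT.1
  obtain hle | hlt := le_or_gt (insert x T).card K
  · have := hM.avail _ hle
    omega
  · have := card_lt_card_availNbrs hbig hK hlt (by omega)
    omega

end DynamicInvariant

section PositionalStrategy

variable {L R : Type} [DecidableEq L] [DecidableEq R]

/-- The position (current matching and last reply) reached after a history when Matcher
replies by `f` to the current matching and request. -/
def positionAfter (f : Finset (L × R) → L → Finset (L × R)) (h : List (ReqMove L R)) :
    Finset (L × R) × Finset (L × R) :=
  h.foldl (fun s r => (f (s.1 \ r.1) r.2 ∪ (s.1 \ r.1), f (s.1 \ r.1) r.2)) (∅, ∅)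

/-- The strategy that replies by `f` to the current matching and request. -/
def positionalStrategy (f : Finset (L × R) → L → Finset (L × R)) : Strategy L R :=
  fun h => (positionAfter f h).2

variable (f : Finset (L × R) → L → Finset (L × R)) (req : ℕ → ReqMove L R)

theorem positionAfter_histUpTo (n : ℕ) :
    positionAfter f (histUpTo req n) =
      (f (matchingAfter (positionalStrategy f) req n \ (req n).1) (req n).2 ∪
        (matchingAfter (positionalStrategy f) req n \ (req n).1),
      f (matchingAfter (positionalStrategy f) req n \ (req n).1) (req n).2) := by
  induction n with
  | zero => simp [positionAfter, histUpTo, matchingAfter]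
  | succ n ih =>
    have hhist : histUpTo req (n + 1) = histUpTo req n ++ [req (n + 1)] := by
      rw [histUpTo, List.ofFn_succ', List.concat_eq_append]
      rfl
    have hfst : (positionAfter f (histUpTo req n)).1 =
        matchingAfter (positionalStrategy f) req (n + 1) := by
      rw [matchingAfter, positionalStrategy, ih]
    rw [← hfst, hhist]
    simp [positionAfter]

theorem positionalStrategy_histUpTo (n : ℕ) :
    positionalStrategy f (histUpTo req n) =
      f (matchingAfter (positionalStrategy f) req n \ (req n).1) (req n).2 := by
  rw [positionalStrategy, positionAfter_histUpTo]

end PositionalStrategy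

end DM

open DM
/-- If a bipartite graph has 1-expansion up to `K`, and every left set `S`
with `K < #S ≤ 2K` satisfies `#N(S) ≥ #S + K`, then it has dynamic matching up to `K`
with load 1. -/
theorem stmt2 (L R : Type) [Fintype L] [Fintype R] [DecidableEq L] [DecidableEq R]
    (Nbr : L → Finset R) (K : ℕ)
    (hexp : Expansion Nbr 1 K)
    (hbig : ∀ S : Finset L, K < S.card → S.card ≤ 2 * K →
      S.card + K ≤ (NbrSet Nbr S).card) :
    DynamicMatching Nbr K 1 := by
  have hreply : ∀ (M : Finset (L × R)) (x : L), ∃ e : Finset (L × R),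
      IsSafe Nbr K M → M.card < K → ∃ y ∈ Nbr x, e = {(x, y)} ∧ IsSafe Nbr K (e ∪ M) := by
    intro M x
    by_cases h : IsSafe Nbr K M ∧ M.card < K
    · obtain ⟨y, hy, hsafe⟩ := h.1.exists_isSafe_insert hbig h.2 x
      exact ⟨{(x, y)}, fun _ _ => ⟨y, hy, rfl, by rwa [← Finset.insert_eq]⟩⟩
    · exact ⟨∅, fun h₁ h₂ => absurd ⟨h₁, h₂⟩ h⟩
  choose f hf using hreply
  refine ⟨positionalStrategy f, fun req n hlegal => ?_⟩
  have hsafe : ∀ m ≤ n + 1, IsSafe Nbr K (matchingAfter (positionalStrategy f) req m) := by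
    intro m
    induction m with
    | zero => exact fun _ => isSafe_empty hexp
    | succ m ih =>
      intro hm
      obtain ⟨y, -, -, h⟩ := hf _ (req m).2 ((ih (by omega)).mono Finset.sdiff_subset)
        (hlegal m (by omega))
      rwa [matchingAfter, positionalStrategy_histUpTo]
  obtain ⟨y, hy, he, -⟩ := hf _ (req n).2 ((hsafe n (by omega)).mono Finset.sdiff_subset)
    (hlegal n le_rfl)
  refine ⟨⟨y, hy, by rw [positionalStrategy_histUpTo, he]⟩, fun z => ?_⟩
  refine Finset.card_le_one.mpr fun p hp q hq => ?_
  rw [Finset.mem_filter] at hp hq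
  exact (hsafe (n + 1) le_rfl).inj p hp.1 q hq.1 (hp.2.trans hq.2.symm)
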